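/- If X and Q are two non-degenerate quadrics in P^4(F_q) such that X ∩ Q contains no projective line, then |X ∩ Q| ≤ 2(q^2 + 1). -/

import Mathlib

/-- A non-degenerate quadric in `ℙ⁴(F_q)`: a nonzero quadratic form in 5 variables
that cannot, after any invertible linear change of variables, be written using
fewer than 5 variables. -/
def NondegQuadric {Fq : Type} [Field Fq]
    (f : MvPolynomial (Fin 5) Fq) : Prop :=
  f.IsHomogeneous 2 ∧ f ≠ 0 ∧
    ∀ A : (Fin 5 → Fq) ≃ₗ[Fq] (Fin 5 → Fq),
      ¬ ∀ x y : Fin 5 → Fq, (∀ i : Fin 5, (i : ℕ) < 4 → x i = y i) →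
        MvPolynomial.eval (A x) f = MvPolynomial.eval (A y) f

open QuadraticMap in
/-- Splitting off a hyperbolic plane through a singular vector. -/
theorem hyp_split {F V : Type*} [Field F] [AddCommGroup V] [Module F V]
    (Q : QuadraticForm F V)
    (hQ : ∀ w, Q w = 0 → (∀ x, polar Q w x = 0) → w = 0)
    (p : V) (hp : p ≠ 0) (hQp : Q p = 0) :
    ∃ (U : Submodule F V) (e : V ≃ F × F × U),
      (∀ w : U, Q w = 0 → (∀ x : U, polar Q w x = 0) → w = 0) ∧
      (∀ v, Q v = (e v).1 * (e v).2.1 + Q (e v).2.2) ∧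
      (∀ v, polar Q p v = (e v).2.1) := by
  have h1 : ∃ x, polar Q p x ≠ 0 := by
    by_contra! h
    exact hp (hQ p hQp h)
  obtain ⟨x, hx⟩ := h1
  obtain ⟨y, hy⟩ : ∃ y, polar Q p y = 1 :=
    ⟨(polar Q p x)⁻¹ • x, by rw [polar_smul_right, smul_eq_mul, inv_mul_cancel₀ hx]⟩
  have hpp : polar Q p p = 0 := by rw [polar_self, hQp, smul_zero]
  obtain ⟨r, hr, hQr⟩ : ∃ r, polar Q p r = 1 ∧ Q r = 0 := by
    refine ⟨y + (-Q y) • p, ?_, ?_⟩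
    · rw [polar_add_right, polar_smul_right, hpp, hy, smul_zero, add_zero]
    · rw [QuadraticMap.map_add Q, QuadraticMap.map_smul, hQp, polar_smul_right, polar_comm, hy]
      simp
  have hrr : polar Q r r = 0 := by rw [polar_self, hQr, smul_zero]
  have hrp : polar Q r p = 1 := by rw [polar_comm, hr]
  let U : Submodule F V :=
    LinearMap.ker (polarBilin Q p) ⊓ LinearMap.ker (polarBilin Q r)
  have hU : ∀ u, u ∈ U ↔ polar Q p u = 0 ∧ polar Q r u = 0 := by
    intro u; simp [U]
  have key : ∀ v, v - polar Q r v • p - polar Q p v • r ∈ U := by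
    intro v
    rw [hU]
    simp [sub_eq_add_neg, polar_add_right, polar_neg_right, polar_smul_right, hpp, hr, hrr, hrp]
  have hUp : ∀ u : U, polar Q p u = 0 := fun u => ((hU u).1 u.2).1
  have hUr : ∀ u : U, polar Q r u = 0 := fun u => ((hU u).1 u.2).2
  let e : V ≃ F × F × U :=
    { toFun := fun v => (polar Q r v, polar Q p v, ⟨_, key v⟩)
      invFun := fun t => t.1 • p + t.2.1 • r + t.2.2
      left_inv := by
        intro v
        simp only
        abel
      right_inv := by
        rintro ⟨a, b, u⟩
        have e1 : polar Q r (a • p + b • r + u) = a := by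
          simp [polar_add_right, polar_smul_right, hrp, hrr, hUr]
        have e2 : polar Q p (a • p + b • r + u) = b := by
          simp [polar_add_right, polar_smul_right, hr, hpp, hUp]
        ext
        · exact e1
        · exact e2
        · simp only [e1, e2]
          abel }
  have he : ∀ v, v = (e v).1 • p + (e v).2.1 • r + (e v).2.2 := fun v => (e.left_inv v).symm
  refine ⟨U, e, ?_, ?_, fun v => rfl⟩
  · intro w hw h
    have : (w : V) = 0 := by
      apply hQ _ hw
      intro x
      rw [he x, polar_add_right, polar_add_right, polar_smul_right, polar_smul_right, h,
        polar_comm _ _ p, polar_comm _ _ r, hUp, hUr]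
      simp
    exact Subtype.ext this
  · intro v
    conv_lhs => rw [he v]
    rw [QuadraticMap.map_add Q, QuadraticMap.map_add Q, QuadraticMap.map_smul, QuadraticMap.map_smul,
      hQp, hQr, polar_add_left, polar_smul_left, polar_smul_left, polar_smul_left,
      polar_smul_right, hr, hUp, hUr]
    simp

theorem card_hyp {F : Type*} [Field F] [Fintype F] (c : F) [Decidable (c = 0)] :
    Nat.card {t : F × F // t.1 * t.2 + c = 0} =
      (Fintype.card F - 1) + if c = 0 then Fintype.card F else 0 := by
  classical
  rw [Nat.card_eq_fintype_card, Fintype.card_subtype, ← Finset.univ_product_univ]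
  have hq : 0 < Fintype.card F := Fintype.card_pos
  rw [Finset.card_filter, Finset.sum_product]
  have : ∀ a : F, (∑ b : F, if a * b + c = 0 then 1 else 0) =
      if a = 0 then (if c = 0 then Fintype.card F else 0) else 1 := by
    intro a
    by_cases ha : a = 0
    · subst ha
      by_cases hc : c = 0 <;> simp [hc]
    · have : ∀ b, (a * b + c = 0) ↔ b = - c / a := by
        intro b
        rw [eq_div_iff ha, mul_comm, add_eq_zero_iff_eq_neg]
      simp [this, ha]
  simp only [this]
  rw [← Finset.add_sum_erase _ _ (Finset.mem_univ (0 : F))]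
  rw [Finset.sum_congr rfl (g := fun _ => 1)
    (fun x hx => by rw [if_neg (Finset.ne_of_mem_erase hx)])]
  simp [Finset.card_erase_of_mem]
  omega

open QuadraticMap in
/-- Counting version of the splitting. -/
theorem hyp_count {F V : Type*} [Field F] [Fintype F] [AddCommGroup V] [Module F V] [Finite V]
    (Q : QuadraticForm F V)
    (hQ : ∀ w, Q w = 0 → (∀ x, polar Q w x = 0) → w = 0)
    (p : V) (hp : p ≠ 0) (hQp : Q p = 0) :
    ∃ (U : Submodule F V),
      (∀ w : U, Q w = 0 → (∀ x : U, polar Q w x = 0) → w = 0) ∧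
      Nat.card V = Fintype.card F * (Fintype.card F * Nat.card U) ∧
      Nat.card {v : V // polar Q p v = 0 ∧ Q v = 0} =
        Fintype.card F * Nat.card {u : U // Q u = 0} ∧
      Nat.card {v : V // Q v = 0} = (Fintype.card F - 1) * Nat.card U +
        Fintype.card F * Nat.card {u : U // Q u = 0} := by
  classical
  obtain ⟨U, e, h1, h2, h3⟩ := hyp_split Q hQ p hp hQp
  refine ⟨U, h1, ?_, ?_, ?_⟩
  · rw [Nat.card_congr e, Nat.card_prod, Nat.card_prod, Nat.card_eq_fintype_card]
  · rw [← Nat.card_eq_fintype_card, ← Nat.card_prod]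
    refine Nat.card_congr
      { toFun := fun v => ((e v).1, ⟨(e v).2.2, ?_⟩)
        invFun := fun t => ⟨e.symm (t.1, 0, t.2.1), ?_⟩
        left_inv := ?_
        right_inv := ?_ }
    · have := h2 v
      rw [← h3, v.2.1, v.2.2] at this
      simpa using this.symm
    · rw [h3, h2]
      simp [t.2.2]
    · intro v
      apply Subtype.ext
      simp only
      rw [Equiv.symm_apply_eq]
      ext
      · rfl
      · rw [← h3, v.2.1]
      · rfl
    · intro t
      ext <;> simp
  · have : {v : V // Q v = 0} ≃ Σ u : U, {t : F × F // t.1 * t.2 + Q u = 0} :=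
      (e.subtypeEquiv (p := fun v => Q v = 0)
        (q := fun t => t.1 * t.2.1 + Q t.2.2 = 0) (fun v => by rw [h2 v])).trans
      { toFun := fun t => ⟨t.1.2.2, (t.1.1, t.1.2.1), t.2⟩
        invFun := fun s => ⟨(s.2.1.1, s.2.1.2, s.1), s.2.2⟩
        left_inv := fun _ => rfl
        right_inv := fun _ => rfl }
    have _ := Fintype.ofFinite U
    rw [Nat.card_congr this, Nat.card_sigma]
    simp only [card_hyp]
    rw [Finset.sum_add_distrib, Nat.card_eq_fintype_card (α := {u : U // Q u = 0}),
      Fintype.card_subtype, Finset.card_filter, Finset.mul_sum]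
    simp [mul_comm]

theorem exists_singular {F V : Type*} [Field F] [Fintype F] [AddCommGroup V] [Module F V]
    (Q : QuadraticForm F V) (b : Module.Basis (Fin 3) F V) : ∃ v, v ≠ 0 ∧ Q v = 0 := by
  classical
  open MvPolynomial in
  let P : MvPolynomial (Fin 3) F :=
    C (Q (b 0)) * (X 0 * X 0) + C (Q (b 1)) * (X 1 * X 1) + C (Q (b 2)) * (X 2 * X 2)
    + C (QuadraticMap.polar Q (b 0) (b 1)) * (X 0 * X 1)
    + C (QuadraticMap.polar Q (b 0) (b 2)) * (X 0 * X 2)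
    + C (QuadraticMap.polar Q (b 1) (b 2)) * (X 1 * X 2)
  have hhom : P.IsHomogeneous 2 := by
    have : ∀ (c : F) (i j : Fin 3),
        (MvPolynomial.C c * (MvPolynomial.X i * MvPolynomial.X j)).IsHomogeneous 2 := by
      intro c i j
      have := ((MvPolynomial.isHomogeneous_X F i).mul (MvPolynomial.isHomogeneous_X F j)).C_mul c
      simpa using this
    exact (((((this _ _ _).add (this _ _ _)).add (this _ _ _)).add (this _ _ _)).add
      (this _ _ _)).add (this _ _ _)
  have hev : ∀ x : Fin 3 → F, MvPolynomial.eval x P =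
      Q (x 0 • b 0 + x 1 • b 1 + x 2 • b 2) := by
    intro x
    rw [QuadraticMap.map_add Q, QuadraticMap.map_add Q]
    simp only [QuadraticMap.map_smul, QuadraticMap.polar_add_left,
      QuadraticMap.polar_smul_left, QuadraticMap.polar_smul_right, smul_eq_mul, P, map_add, map_mul,
      MvPolynomial.eval_C, MvPolynomial.eval_X]
    ring
  obtain ⟨n, hpc⟩ := CharP.exists F
  have hpr : n.Prime := (CharP.char_is_prime F n)
  have hdvd := char_dvd_card_solutions n (f := P)
    (lt_of_le_of_lt hhom.totalDegree_le (by simp))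
  by_contra! hcon
  have hone : Fintype.card {x : Fin 3 → F // MvPolynomial.eval x P = 0} = 1 := by
    rw [Fintype.card_eq_one_iff]
    refine ⟨⟨0, by rw [hev]; simp⟩, ?_⟩
    rintro ⟨x, hx⟩
    rw [hev] at hx
    by_contra hne
    apply hcon _ _ hx
    intro h0
    apply hne
    apply Subtype.ext
    have h3 : ∑ i, x i • b i = 0 := by rw [Fin.sum_univ_three]; exact h0
    funext i
    exact Fintype.linearIndependent_iff.1 b.linearIndependent x h3 i
  rw [hone] at hdvd
  exact hpr.one_lt.ne' (Nat.dvd_one.1 hdvd)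

open QuadraticMap in
theorem card_dim_one {F V : Type*} [Field F] [Fintype F] [AddCommGroup V] [Module F V] [Finite V]
    (Q : QuadraticForm F V)
    (hQ : ∀ w, Q w = 0 → (∀ x, polar Q w x = 0) → w = 0)
    (hV : Nat.card V = Fintype.card F) : Nat.card {v : V // Q v = 0} = 1 := by
  have hfr : Module.finrank F V = 1 := by
    have := Module.natCard_eq_pow_finrank (K := F) (V := V)
    rw [hV, Nat.card_eq_fintype_card] at this
    exact (Nat.pow_right_injective (Fintype.one_lt_card (α := F)) (by simpa using this)).symm
  rw [Nat.card_eq_one_iff_unique]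
  refine ⟨⟨?_⟩, ⟨⟨0, by simp⟩⟩⟩
  have h0 : ∀ w, Q w = 0 → w = 0 := by
    intro w hw
    by_contra hne
    apply hne
    apply hQ w hw
    intro x
    obtain ⟨c, rfl⟩ := (finrank_eq_one_iff_of_nonzero' w hne).1 hfr x
    rw [polar_smul_right, polar_self, hw]
    simp
  rintro ⟨a, ha⟩ ⟨b, hb⟩
  apply Subtype.ext
  simp [h0 a ha, h0 b hb]

open QuadraticMap in
theorem card_dim_three {F V : Type*} [Field F] [Fintype F] [AddCommGroup V] [Module F V] [Finite V]
    (Q : QuadraticForm F V)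
    (hQ : ∀ w, Q w = 0 → (∀ x, polar Q w x = 0) → w = 0)
    (hV : Nat.card V = Fintype.card F ^ 3) :
    Nat.card {v : V // Q v = 0} = Fintype.card F ^ 2 := by
  have h1 := Fintype.one_lt_card (α := F)
  have hfr : Module.finrank F V = 3 := by
    have := Module.natCard_eq_pow_finrank (K := F) (V := V)
    rw [hV, Nat.card_eq_fintype_card] at this
    exact (Nat.pow_right_injective h1 this).symm
  obtain ⟨p, hp, hQp⟩ := exists_singular Q (Module.finBasisOfFinrankEq F V hfr)
  obtain ⟨U, hU, hc, -, hS⟩ := hyp_count Q hQ p hp hQp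
  have hcU : Nat.card U = Fintype.card F := by
    rw [hV] at hc
    have : Fintype.card F * (Fintype.card F * Nat.card U) =
      Fintype.card F * (Fintype.card F * Fintype.card F) := by rw [← hc]; ring
    exact Nat.eq_of_mul_eq_mul_left (by omega) (Nat.eq_of_mul_eq_mul_left (by omega) this)
  have h2 := card_dim_one (Q.comp U.subtype) hU hcU
  simp only [QuadraticMap.comp_apply, Submodule.subtype_apply] at h2
  rw [hS, h2, hcU]
  obtain ⟨m, hm⟩ : ∃ m, Fintype.card F = m + 1 := ⟨Fintype.card F - 1, by omega⟩
  rw [hm]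
  simp
  ring

open QuadraticMap in
theorem card_dim_five {F V : Type*} [Field F] [Fintype F] [AddCommGroup V] [Module F V] [Finite V]
    (Q : QuadraticForm F V)
    (hQ : ∀ w, Q w = 0 → (∀ x, polar Q w x = 0) → w = 0)
    (hV : Nat.card V = Fintype.card F ^ 5) (p : V) (hp : p ≠ 0) (hQp : Q p = 0) :
    Nat.card {v : V // polar Q p v = 0 ∧ Q v = 0} = Fintype.card F ^ 3 ∧
    Nat.card {v : V // Q v = 0} = Fintype.card F ^ 4 := by
  have h1 := Fintype.one_lt_card (α := F)
  obtain ⟨U, hU, hc, hT, hS⟩ := hyp_count Q hQ p hp hQp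
  have hcU : Nat.card U = Fintype.card F ^ 3 := by
    rw [hV] at hc
    have : Fintype.card F * (Fintype.card F * Nat.card U) =
      Fintype.card F * (Fintype.card F * Fintype.card F ^ 3) := by rw [← hc]; ring
    exact Nat.eq_of_mul_eq_mul_left (by omega) (Nat.eq_of_mul_eq_mul_left (by omega) this)
  have h2 := card_dim_three (Q.comp U.subtype) hU hcU
  simp only [QuadraticMap.comp_apply, Submodule.subtype_apply] at h2
  rw [hT, hS, h2, hcU]
  refine ⟨by ring, ?_⟩
  obtain ⟨m, hm⟩ : ∃ m, Fintype.card F = m + 1 := ⟨Fintype.card F - 1, by omega⟩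
  rw [hm]
  simp
  ring

/-- A homogeneous polynomial of degree two is a quadratic form. -/
theorem exists_quadForm {F : Type*} [Field F] (f : MvPolynomial (Fin 5) F)
    (hf : f.IsHomogeneous 2) :
    ∃ Q : QuadraticForm F (Fin 5 → F), ∀ v, Q v = MvPolynomial.eval v f := by
  classical
  have hmon : ∀ d ∈ f.support, ∃ Q : QuadraticForm F (Fin 5 → F),
      ∀ v, Q v = MvPolynomial.eval v (MvPolynomial.monomial d (f.coeff d)) := by
    intro d hd
    have hdeg : d.degree = 2 := by
      have := hf (MvPolynomial.mem_support_iff.1 hd)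
      rw [Finsupp.degree_eq_weight_one (R := ℕ)]
      exact this
    have step : ∀ (n : ℕ) (d : Fin 5 →₀ ℕ), d.degree = n + 1 →
        ∃ i d', d = Finsupp.single i 1 + d' ∧ d'.degree = n := by
      intro n d h
      have : d ≠ 0 := by rintro rfl; simp at h
      obtain ⟨i, hi⟩ := Finsupp.ne_iff.1 this
      have hle : Finsupp.single i 1 ≤ d := by
        rw [Finsupp.single_le_iff]
        exact Nat.one_le_iff_ne_zero.2 hi
      refine ⟨i, d - Finsupp.single i 1, (add_tsub_cancel_of_le hle).symm, ?_⟩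
      have h2 := congrArg Finsupp.degree (add_tsub_cancel_of_le hle)
      rw [map_add, h, Finsupp.degree_single] at h2
      omega
    obtain ⟨i, d', rfl, h'⟩ := step 1 d hdeg
    obtain ⟨j, d'', rfl, h''⟩ := step 0 d' h'
    have : d'' = 0 := (Finsupp.degree_eq_zero_iff d'').1 h''
    subst this
    refine ⟨f.coeff (Finsupp.single i 1 + (Finsupp.single j 1 + 0)) • QuadraticMap.linMulLin (LinearMap.proj i) (LinearMap.proj j), ?_⟩
    intro v
    rw [add_zero, MvPolynomial.eval_monomial, Finsupp.prod_add_index' (by simp)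
      (by intros; rw [pow_add])]
    simp
  choose! R hR using hmon
  refine ⟨∑ d ∈ f.support, R d, ?_⟩
  intro v
  conv_rhs => rw [f.as_sum]
  rw [map_sum, _root_.sum_apply]
  exact Finset.sum_congr rfl (fun d hd => hR d hd v)

/-- The radical of a nondegenerate quadric is trivial. -/
theorem radical_trivial {F : Type} [Field F] (f : MvPolynomial (Fin 5) F)
    (hf : NondegQuadric f) (Q : QuadraticForm F (Fin 5 → F))
    (hQ : ∀ v, Q v = MvPolynomial.eval v f) :
    ∀ w, Q w = 0 → (∀ x, QuadraticMap.polar Q w x = 0) → w = 0 := by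
  intro w hw hpol
  by_contra hne
  obtain ⟨A, hA⟩ : ∃ A : (Fin 5 → F) ≃ₗ[F] (Fin 5 → F), A (Pi.single 4 1) = w := by
    have hne1 : (Pi.single 4 1 : Fin 5 → F) ≠ 0 := by
      intro h
      have := congrFun h 4
      simp at this
    obtain ⟨A, hA⟩ := Submodule.exists_linearEquiv_restrict_eq
      ((LinearEquiv.toSpanNonzeroSingleton F _ _ hne1).symm.trans
        (LinearEquiv.toSpanNonzeroSingleton F _ _ hne))
    refine ⟨A, ?_⟩
    have h := hA ⟨_, Submodule.mem_span_singleton_self _⟩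
    rw [← h, LinearEquiv.trans_apply]
    have h2 : (LinearEquiv.toSpanNonzeroSingleton F _ _ hne1).symm
        ⟨_, Submodule.mem_span_singleton_self _⟩ = 1 := LinearEquiv.coord_self F _ _ hne1
    rw [h2]
    simp
  apply hf.2.2 A
  intro x y hxy
  have hx : x = (x 4 - y 4) • Pi.single 4 1 + y := by
    funext i
    by_cases hi : i = 4
    · subst hi; simp
    · have h4 : (i : ℕ) < 4 := by
        have := i.2
        have h5 : (i : ℕ) ≠ 4 := fun h => hi (Fin.ext h)
        omega
      simp [hxy i h4, hi]
  rw [← hQ, ← hQ, hx, _root_.map_add, _root_.map_smul, hA, QuadraticMap.map_add Q,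
    QuadraticMap.map_smul, QuadraticMap.polar_smul_left, hw, hpol]
  simp

open QuadraticMap in
/-- A binary form has at most two projective zeros unless it vanishes identically. -/
theorem line_zeros {F V : Type*} [Field F] [Fintype F] [DecidableEq F] [AddCommGroup V] [Module F V]
    (G : QuadraticForm F V) (u v : V)
    (h : ¬ (G u = 0 ∧ polar G u v = 0 ∧ G v = 0)) :
    (∑ t : F, if G (u + t • v) = 0 then 1 else 0) + (if G v = 0 then 1 else 0) ≤ 2 := by
  have hev : ∀ t : F, G (u + t • v) = G v * (t * t) + polar G u v * t + G u := by
    intro t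
    rw [QuadraticMap.map_add G, QuadraticMap.map_smul, polar_smul_right, smul_eq_mul, smul_eq_mul]
    ring
  simp only [hev]
  rw [← Finset.card_filter]
  by_cases hv : G v = 0
  · rw [if_pos hv]
    have : Finset.card {t : F | G v * (t * t) + polar G u v * t + G u = 0} ≤ 1 := by
      rw [Finset.card_le_one]
      intro a ha b hb
      simp only [Finset.mem_filter, Finset.mem_univ, true_and, hv, zero_mul, zero_add] at ha hb
      have h1 : polar G u v * (a - b) = 0 := by linear_combination ha - hb
      rcases mul_eq_zero.1 h1 with h2 | h2
      · rw [h2, zero_mul, zero_add] at ha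
        exact absurd ⟨ha, h2, hv⟩ h
      · exact sub_eq_zero.1 h2
    omega
  · rw [if_neg hv, add_zero]
    by_contra! hlt
    obtain ⟨a, b, c, ha, hb, hc, hab, hac, hbc⟩ := Finset.two_lt_card_iff.1 hlt
    simp only [Finset.mem_filter, Finset.mem_univ, true_and] at ha hb hc
    have h1 : (a - b) * (G v * (a + b) + polar G u v) = 0 := by linear_combination ha - hb
    have h2 : (a - c) * (G v * (a + c) + polar G u v) = 0 := by linear_combination ha - hc
    have h1' := (mul_eq_zero.1 h1).resolve_left (sub_ne_zero.2 hab)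
    have h2' := (mul_eq_zero.1 h2).resolve_left (sub_ne_zero.2 hac)
    have h3 : G v * (b - c) = 0 := by linear_combination h1' - h2'
    rcases mul_eq_zero.1 h3 with h4 | h4
    · exact hv h4
    · exact hbc (sub_eq_zero.1 h4)

open QuadraticMap in
/-- Ordered bases of totally singular lines. -/
def SingPair {F V : Type*} [Field F] [AddCommGroup V] [Module F V]
    (Q : QuadraticForm F V) (t : V × V) : Prop :=
  Q t.1 = 0 ∧ polar Q t.1 t.2 = 0 ∧ Q t.2 = 0 ∧ LinearIndependent F ![t.1, t.2]

open QuadraticMap in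
theorem SingPair.swap {F V : Type*} [Field F] [AddCommGroup V] [Module F V]
    {Q : QuadraticForm F V} {t : V × V} (h : SingPair Q t) : SingPair Q t.swap := by
  obtain ⟨h1, h2, h3, h4⟩ := h
  refine ⟨h3, by rw [polar_comm]; exact h2, h1, ?_⟩
  rw [LinearIndependent.pair_iff] at h4 ⊢
  intro a b hab
  exact (h4 b a (by rw [add_comm]; exact hab)).symm

open QuadraticMap in
theorem SingPair.shear {F V : Type*} [Field F] [AddCommGroup V] [Module F V]
    {Q : QuadraticForm F V} {t : V × V} (h : SingPair Q t) (c : F) :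
    SingPair Q (t.1 + c • t.2, t.2) := by
  obtain ⟨h1, h2, h3, h4⟩ := h
  refine ⟨?_, ?_, h3, ?_⟩
  · simp only
    rw [QuadraticMap.map_add Q, QuadraticMap.map_smul, polar_smul_right, h1, h2, h3]
    simp
  · simp only
    rw [polar_add_left, polar_smul_left, h2, polar_self, h3]
    simp
  · rw [LinearIndependent.pair_iff] at h4 ⊢
    intro a b hab
    have := h4 a (a * c + b) (by rw [← hab]; module)
    obtain ⟨rfl, h5⟩ := this
    simpa using h5

open QuadraticMap in
theorem fiber_card {F V : Type*} [Field F] [Fintype F] [AddCommGroup V] [Module F V] [Finite V]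
    (Q : QuadraticForm F V)
    (hQ : ∀ w, Q w = 0 → (∀ x, polar Q w x = 0) → w = 0)
    (hV : Nat.card V = Fintype.card F ^ 5) (u : V) (hu : u ≠ 0) (hQu : Q u = 0) :
    Nat.card {v : V // SingPair Q (u, v)} + Fintype.card F = Fintype.card F ^ 3 := by
  classical
  rw [← (card_dim_five Q hQ hV u hu hQu).1, ← Nat.card_eq_fintype_card, ← Nat.card_sum]
  have hmem : ∀ c : F, polar Q u (c • u) = 0 ∧ Q (c • u) = 0 := by
    intro c
    rw [polar_smul_right, polar_self, QuadraticMap.map_smul, hQu]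
    simp
  have hli : ∀ v, LinearIndependent F ![u, v] ↔ ∀ c : F, c • u ≠ v := by
    intro v
    exact LinearIndependent.pair_iff' hu
  refine Nat.card_eq_of_bijective
    (Sum.elim (fun v => ⟨v.1, v.2.2.1, v.2.2.2.1⟩) (fun c : F => ⟨c • u, hmem c⟩)) ⟨?_, ?_⟩
  · refine Function.Injective.sumElim ?_ ?_ ?_
    · intro a b hab
      simpa [Subtype.ext_iff] using hab
    · intro a b hab
      have : a • u = b • u := congrArg Subtype.val hab
      exact smul_left_injective F hu this
    · intro a b hab
      have : a.1 = b • u := congrArg Subtype.val hab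
      exact (hli a.1).1 a.2.2.2.2 b this.symm
  · rintro ⟨v, hv1, hv2⟩
    by_cases h : ∃ c : F, c • u = v
    · obtain ⟨c, hc⟩ := h
      exact ⟨Sum.inr c, Subtype.ext hc⟩
    · push Not at h
      exact ⟨Sum.inl ⟨v, hQu, hv1, hv2, (hli v).2 h⟩, rfl⟩

open QuadraticMap in
theorem main_count {F V : Type*} [Field F] [Fintype F] [AddCommGroup V] [Module F V] [Finite V]
    (Q G : QuadraticForm F V)
    (hQ : ∀ w, Q w = 0 → (∀ x, polar Q w x = 0) → w = 0)
    (hV : Nat.card V = Fintype.card F ^ 5)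
    (hline : ∀ u v, SingPair Q (u, v) → ¬ (G u = 0 ∧ polar G u v = 0 ∧ G v = 0)) :
    Nat.card {v : V // v ≠ 0 ∧ Q v = 0 ∧ G v = 0} ≤
      2 * ((Fintype.card F - 1) * (Fintype.card F ^ 2 + 1)) := by
  classical
  have _ := Fintype.ofFinite V
  by_cases hex : ∃ p : V, p ≠ 0 ∧ Q p = 0
  swap
  · have : IsEmpty {v : V // v ≠ 0 ∧ Q v = 0 ∧ G v = 0} :=
      ⟨fun v => hex ⟨v.1, v.2.1, v.2.2.1⟩⟩
    simp
  obtain ⟨p, hp, hQp⟩ := hex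
  have hS := (card_dim_five Q hQ hV p hp hQp).2
  have hq := Fintype.one_lt_card (α := F)
  set q := Fintype.card F with hqdef
  let P : Finset (V × V) := {t | SingPair Q t}
  have hP : ∀ t, t ∈ P ↔ SingPair Q t := by intro t; simp [P]
  -- counting pairs by their first entry
  have hfib : ∀ R : V → Prop, (∑ t ∈ P, if R t.1 then 1 else 0) =
      Nat.card {v : V // v ≠ 0 ∧ Q v = 0 ∧ R v} * (q ^ 3 - q) := by
    intro R
    rw [Finset.sum_filter, ← Finset.univ_product_univ, Finset.sum_product,
      Nat.card_eq_fintype_card, Fintype.card_subtype, Finset.card_filter, Finset.sum_mul]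
    apply Finset.sum_congr rfl
    intro u _
    by_cases h : u ≠ 0 ∧ Q u = 0
    · by_cases hR : R u
      · have h3 := fiber_card Q hQ hV u h.1 h.2
        rw [Nat.card_eq_fintype_card, Fintype.card_subtype, Finset.card_filter] at h3
        simp only [hR, if_true]
        rw [if_pos ⟨h.1, h.2, trivial⟩]
        rw [← hqdef] at h3
        omega
      · simp [hR]
    · rw [if_neg (fun h' => h ⟨h'.1, h'.2.1⟩), zero_mul]
      apply Finset.sum_eq_zero
      intro v _
      rw [if_neg]
      rintro ⟨h1, -, -, h4⟩
      exact h ⟨h4.ne_zero 0, h1⟩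
  have hPc : P.card = (q ^ 4 - 1) * (q ^ 3 - q) := by
    have h1 := hfib (fun _ => True)
    simp only [if_true, and_true] at h1
    rw [Finset.card_eq_sum_ones, h1]
    congr 1
    rw [← hS, Nat.card_eq_fintype_card, Nat.card_eq_fintype_card, Fintype.card_subtype,
      Fintype.card_subtype, ← Finset.filter_filter, Finset.filter_ne' Finset.univ (0 : V),
      Finset.filter_erase, Finset.card_erase_of_mem]
    simp
  have hM := hfib (fun v => G v = 0)
  set M := ∑ t ∈ P, if G t.1 = 0 then 1 else 0 with hMdef
  have hswap : (∑ t ∈ P, if G t.2 = 0 then 1 else 0) = M := by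
    refine Finset.sum_bij' (fun t _ => t.swap) (fun t _ => t.swap) ?_ ?_ ?_ ?_ ?_
    · intro t ht; exact (hP _).2 ((hP _).1 ht).swap
    · intro t ht; exact (hP _).2 ((hP _).1 ht).swap
    · intro t _; simp
    · intro t _; simp
    · intro t _; simp
  have hshear : ∀ c : F, (∑ t ∈ P, if G (t.1 + c • t.2) = 0 then 1 else 0) = M := by
    intro c
    refine Finset.sum_bij' (fun t _ => (t.1 + c • t.2, t.2))
      (fun t _ => (t.1 + (-c) • t.2, t.2)) ?_ ?_ ?_ ?_ ?_
    · intro t ht; exact (hP _).2 (((hP _).1 ht).shear c)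
    · intro t ht; exact (hP _).2 (((hP _).1 ht).shear (-c))
    · intro t _; simp
    · intro t _; simp
    · intro t _; simp
  have htot : q * M + M ≤ 2 * P.card := by
    calc q * M + M = ∑ t ∈ P, ((∑ c : F, if G (t.1 + c • t.2) = 0 then 1 else 0)
          + (if G t.2 = 0 then 1 else 0)) := by
          rw [Finset.sum_add_distrib, hswap, Finset.sum_comm]
          simp [hshear, hqdef]
      _ ≤ ∑ t ∈ P, 2 := Finset.sum_le_sum (fun t ht =>
          line_zeros G t.1 t.2 (hline t.1 t.2 ((hP t).1 ht)))
      _ = 2 * P.card := by simp [mul_comm]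
  rw [hPc, hM] at htot
  generalize Nat.card {v : V // v ≠ 0 ∧ Q v = 0 ∧ G v = 0} = N at htot ⊢
  clear_value q
  obtain ⟨m, rfl⟩ : ∃ m, q = m + 1 := ⟨q - 1, by omega⟩
  have hK : 0 < (m + 1) ^ 3 - (m + 1) := by
    have : (m + 1) ^ 1 < (m + 1) ^ 3 :=
      Nat.pow_lt_pow_right hq (by norm_num)
    rw [pow_one] at this
    omega
  generalize (m + 1) ^ 3 - (m + 1) = K at htot hK
  have h4 : (m + 1) ^ 4 - 1 = (m + 2) * (m * ((m + 1) ^ 2 + 1)) := by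
    have : (m + 1) ^ 4 = (m + 2) * (m * ((m + 1) ^ 2 + 1)) + 1 := by ring
    omega
  rw [h4] at htot
  rw [Nat.add_sub_cancel]
  have : ((m + 2) * K) * N ≤ ((m + 2) * K) * (2 * (m * ((m + 1) ^ 2 + 1))) := by
    calc _ = (m + 1) * (N * K) + N * K := by ring
      _ ≤ _ := htot
      _ = _ := by ring
  exact Nat.le_of_mul_le_mul_left this (by positivity)

/-- If `X` and `Q` are two non-degenerate quadrics in `ℙ⁴(F_q)` whose intersection
contains no projective line, then `|X ∩ Q| ≤ 2(q² + 1)`. -/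
theorem stmt_15 (q : ℕ) (Fq : Type) [Field Fq] [Fintype Fq]
    (hq : Fintype.card Fq = q)
    (f g : MvPolynomial (Fin 5) Fq)
    (hf : NondegQuadric f) (hg : NondegQuadric g)
    (hline : ¬ ∃ W : Submodule Fq (Fin 5 → Fq), Module.finrank Fq W = 2 ∧
      ∀ v ∈ W, MvPolynomial.eval v f = 0 ∧ MvPolynomial.eval v g = 0) :
    Nat.card {x : Projectivization Fq (Fin 5 → Fq) |
        MvPolynomial.eval x.rep f = 0 ∧ MvPolynomial.eval x.rep g = 0}
      ≤ 2 * (q ^ 2 + 1) := by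
  classical
  obtain ⟨Q, hQ⟩ := exists_quadForm f hf.1
  obtain ⟨G, hG⟩ := exists_quadForm g hg.1
  have hrad := radical_trivial f hf Q hQ
  have hq1 : 1 < q := hq ▸ Fintype.one_lt_card (α := Fq)
  have hcount := main_count Q G hrad (by simp) (by
    rintro u v ⟨h1, h2, h3, h4⟩ ⟨h5, h6, h7⟩
    apply hline
    refine ⟨Submodule.span Fq (Set.range ![u, v]), ?_, ?_⟩
    · rw [finrank_span_eq_card h4]
      simp
    · intro w hw
      rw [Matrix.range_cons, Matrix.range_cons, Matrix.range_empty, Set.union_empty,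
        Set.singleton_union, Submodule.mem_span_pair] at hw
      obtain ⟨a, b, rfl⟩ := hw
      simp only at h1 h2 h3
      rw [← hQ, ← hG, QuadraticMap.map_add Q, QuadraticMap.map_add G]
      simp only [QuadraticMap.map_smul, QuadraticMap.polar_smul_left,
        QuadraticMap.polar_smul_right, h1, h2, h3, h5, h6, h7, smul_zero, add_zero, and_self])
  rw [hq] at hcount
  simp only [hQ, hG] at hcount
  have hinj : Nat.card ({x : Projectivization Fq (Fin 5 → Fq) |
        MvPolynomial.eval x.rep f = 0 ∧ MvPolynomial.eval x.rep g = 0} × Fqˣ) ≤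
      Nat.card {v : Fin 5 → Fq // v ≠ 0 ∧ MvPolynomial.eval v f = 0 ∧
        MvPolynomial.eval v g = 0} := by
    refine Nat.card_le_card_of_injective
      (fun s => ⟨(s.2 : Fq) • s.1.1.rep, ?_, ?_, ?_⟩) ?_
    · exact smul_ne_zero s.2.ne_zero s.1.1.rep_nonzero
    · rw [← hQ, QuadraticMap.map_smul, hQ, s.1.2.1, smul_zero]
    · rw [← hG, QuadraticMap.map_smul, hG, s.1.2.2, smul_zero]
    · rintro ⟨⟨x, hx⟩, a⟩ ⟨⟨y, hy⟩, b⟩ h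
      have h' : (a : Fq) • x.rep = (b : Fq) • y.rep := congrArg Subtype.val h
      have hxy : x = y := by
        rw [← x.mk_rep, ← y.mk_rep, Projectivization.mk_eq_mk_iff']
        refine ⟨(a : Fq)⁻¹ * b, ?_⟩
        rw [mul_smul, ← h', smul_smul, inv_mul_cancel₀ a.ne_zero, one_smul]
      subst hxy
      have hab : a = b := Units.ext (smul_left_injective Fq x.rep_nonzero h')
      rw [hab]
  rw [Nat.card_prod, Nat.card_units, Nat.card_eq_fintype_card (α := Fq), hq] at hinj
  have h5 := hinj.trans hcount
  have hq0 : 0 < q - 1 := by omega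
  refine le_of_mul_le_mul_left ?_ hq0
  calc _ = _ := mul_comm _ _
    _ ≤ _ := h5
    _ = _ := by ring
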